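/- Let Q be a nonempty finite state set and let c : Q × Q → ℕ be transition counts such that for every i ∈ Q the row total C_i = Σ_{j∈Q} c_{ij} is positive. Over all row-stochastic matrices h on Q (h_{ij} ≥ 0 and Σ_{j∈Q} h_{ij} = 1 for each i), the likelihood ∏_{i∈Q} ∏_{j∈Q} h_{ij}^{c_{ij}} is maximized by the empirical transition frequencies h_{ij} = c_{ij} / C_i; that is, for every row-stochastic matrix h, ∏_{i,j} h_{ij}^{c_{ij}} ≤ ∏_{i,j} (c_{ij}/C_i)^{c_{ij}}. -/

import Mathlib

/-- For transition counts `c : Q × Q → ℕ` on a nonempty finite state set `Q`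
with every row total `C i = ∑ j, c i j` positive, the likelihood
`∏ i, ∏ j, h i j ^ c i j` over row-stochastic matrices `h` on `Q` is maximized by the
empirical transition frequencies `h i j = c i j / C i`.  (Natural-number exponents, so
`0 ^ 0 = 1`.) -/
theorem mle_transition_matrix
    {Q : Type*} [Fintype Q] [Nonempty Q]
    (c : Q → Q → ℕ) (hC : ∀ i, 0 < ∑ j, c i j)
    (h : Q → Q → ℝ) (h0 : ∀ i j, 0 ≤ h i j) (h1 : ∀ i, ∑ j, h i j = 1) :
    ∏ i, ∏ j, h i j ^ c i j ≤
      ∏ i, ∏ j, ((c i j : ℝ) / ((∑ k, c i k : ℕ) : ℝ)) ^ c i j := by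
  apply Finset.prod_le_prod
  · intro i _
    exact Finset.prod_nonneg fun j _ => pow_nonneg (h0 i j) _
  intro i _
  have hCi : (0 : ℝ) < ((∑ k, c i k : ℕ) : ℝ) := by exact_mod_cast hC i
  have hsum : ∑ j, (c i j : ℝ) = ((∑ k, c i k : ℕ) : ℝ) := by push_cast; rfl
  generalize ((∑ k, c i k : ℕ) : ℝ) = C at hCi hsum ⊢
  have key : ∀ j, h i j ^ c i j ≤
      ((c i j : ℝ) / C) ^ c i j * Real.exp (C * h i j - c i j) := by
    intro j
    rcases Nat.eq_zero_or_pos (c i j) with hc | hc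
    · simp only [hc, pow_zero, Nat.cast_zero, sub_zero, one_mul]
      exact Real.one_le_exp (mul_nonneg hCi.le (h0 i j))
    · have hc' : (0 : ℝ) < c i j := by exact_mod_cast hc
      have hp : 0 < (c i j : ℝ) / C := div_pos hc' hCi
      have hx := Real.add_one_le_exp (h i j / ((c i j : ℝ) / C) - 1)
      rw [sub_add_cancel, div_le_iff₀ hp] at hx
      have hx2 := pow_le_pow_left₀ (h0 i j) hx (c i j)
      rw [mul_pow, ← Real.exp_nat_mul, mul_comm] at hx2
      have he : (c i j : ℝ) * (h i j / ((c i j : ℝ) / C) - 1) = C * h i j - c i j := by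
        field_simp
      rwa [he] at hx2
  calc ∏ j, h i j ^ c i j
      ≤ ∏ j, (((c i j : ℝ) / C) ^ c i j * Real.exp (C * h i j - c i j)) :=
        Finset.prod_le_prod (fun j _ => pow_nonneg (h0 i j) _) fun j _ => key j
    _ = ∏ j, ((c i j : ℝ) / C) ^ c i j := by
        rw [Finset.prod_mul_distrib, ← Real.exp_sum, Finset.sum_sub_distrib,
          ← Finset.mul_sum, h1, hsum]
        simp
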